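/- arXiv:1908.10532 — 2 statements merged into one kernel-verified Lean document; each statement's English description precedes it below -/
import Mathlib

section
/- For f, g ∈ L with f ≠ 1_{{1}} and g ≠ 1_{{1}}: (f✶g)^L(t) = max(f^L(t), g^L(t)) for t ∈ [0, η_{f,g}) and (f✶g)^L(t) = 1 for t ∈ [η_{f,g}, 1]; moreover (f✶g)^R(t) = 1 for t ∈ [0, ξ_{f,g}), (f✶g)^R(ξ_{f,g}) = min(f^R(ξ_{f,g}), g^R(ξ_{f,g})), and (f✶g)^R(t) = 0 for t ∈ (ξ_{f,g}, 1]. -/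
noncomputable section

attribute [local instance] Classical.propDecidable

instance : Fact ((0:ℝ) ≤ 1) := ⟨zero_le_one⟩

/-- The unit interval `I = [0,1]`. -/
abbrev I01 := unitInterval

/-- `f^L (x) = sup {f y | y ≤ x}`. -/
def funL (f : I01 → I01) (x : I01) : I01 := sSup (f '' {y | y ≤ x})

/-- `f^R (x) = sup {f y | y ≥ x}`. -/
def funR (f : I01 → I01) (x : I01) : I01 := sSup (f '' {y | x ≤ y})

/-- `f^{Lw}`. -/
def funLw (f : I01 → I01) (x : I01) : I01 :=
  if x = 0 then f 0 else sSup (f '' {y | y < x})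

/-- A function is normal if `sup {f x | x ∈ I} = 1`. -/
def NormalFn (f : I01 → I01) : Prop := sSup (Set.range f) = 1

/-- A function is convex in the fuzzy sense. -/
def ConvexFn (f : I01 → I01) : Prop :=
  ∀ x y z : I01, x ≤ y → y ≤ z → min (f x) (f z) ≤ f y

/-- `L`, the set of all normal and convex functions from `I` to `I`. -/
def NC : Set (I01 → I01) := {f | NormalFn f ∧ ConvexFn f}

/-- Characteristic function of a subset of `I`. -/
def ind (B : Set I01) : I01 → I01 := fun x => if x ∈ B then 1 else 0

/-- `(f ⊓ g)(x) = sup {min (f y) (g z) | min y z = x}`. -/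
def meet (f g : I01 → I01) : I01 → I01 := fun x =>
  sSup {v | ∃ y z : I01, min y z = x ∧ v = min (f y) (g z)}

/-- The partial order `f ⊑ g` iff `f ⊓ g = f`. -/
def sqle (f g : I01 → I01) : Prop := meet f g = f

/-- `η_{f,g}`. -/
def etaLG (f g : I01 → I01) : I01 :=
  min (sInf {x | funL f x = 1}) (sInf {x | funL g x = 1})

/-- `ξ_{f,g}`. -/
def xiLG (f g : I01 → I01) : I01 :=
  min (sSup {x | funR f x = 1}) (sSup {x | funR g x = 1})

/-- The operation `✶`. -/
def starOp (f g : I01 → I01) : I01 → I01 :=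
  if f = ind {1} then g
  else if g = ind {1} then f
  else fun t =>
    if t < etaLG f g then max (funL f t) (funL g t)
    else if t < xiLG f g then 1
    else if t = xiLG f g then min (funR f (xiLG f g)) (funR g (xiLG f g))
    else 0

/-- A t-norm on `I`. -/
structure IsTnormI (op : I01 → I01 → I01) : Prop where
  comm : ∀ x y : I01, op x y = op y x
  assoc : ∀ x y z : I01, op (op x y) z = op x (op y z)
  mono : ∀ x y z : I01, x ≤ y → op x z ≤ op y z ∧ op z x ≤ op z y
  one_op : ∀ x : I01, op 1 x = x
  op_one : ∀ x : I01, op x 1 = x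

/-- A t-conorm on `I`. -/
structure IsTconormI (op : I01 → I01 → I01) : Prop where
  comm : ∀ x y : I01, op x y = op y x
  assoc : ∀ x y z : I01, op (op x y) z = op x (op y z)
  mono : ∀ x y z : I01, x ≤ y → op x z ≤ op y z ∧ op z x ≤ op z y
  zero_op : ∀ x : I01, op 0 x = x
  op_zero : ∀ x : I01, op x 0 = x

/-- The convolution operation `(f ⋏ g)(x) = sup {st (f y) (g z) | tri y z = x}`. -/
def conv (st tri : I01 → I01 → I01) (f g : I01 → I01) : I01 → I01 := fun x =>
  sSup {v | ∃ y z : I01, tri y z = x ∧ v = st (f y) (g z)}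

/-- Complementation `(¬ f)(x) = f (1 - x)`. -/
def negf (f : I01 → I01) : I01 → I01 := fun x => f (unitInterval.symm x)

/-- The dual operation `f ◇^∁ g = ¬((¬f) ◇ (¬g))`. -/
def dualOp (op : (I01 → I01) → (I01 → I01) → (I01 → I01)) :
    (I01 → I01) → (I01 → I01) → (I01 → I01) :=
  fun f g => negf (op (negf f) (negf g))

/-- A t-norm on `L` according to the basic axioms (O1)--(O4). -/
def IsTnormOnL (T : (I01 → I01) → (I01 → I01) → (I01 → I01)) : Prop :=
  (∀ f ∈ NC, ∀ g ∈ NC, T f g = T g f) ∧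
  (∀ f ∈ NC, ∀ g ∈ NC, ∀ h ∈ NC, T (T f g) h = T f (T g h)) ∧
  (∀ f ∈ NC, T f (ind {1}) = f) ∧
  (∀ f ∈ NC, ∀ g ∈ NC, ∀ h ∈ NC, sqle f g → sqle (T f h) (T g h))

/-- A t-conorm on `L` according to the basic axioms (O1), (O2), (O3'), (O4). -/
def IsTconormOnL (S : (I01 → I01) → (I01 → I01) → (I01 → I01)) : Prop :=
  (∀ f ∈ NC, ∀ g ∈ NC, S f g = S g f) ∧
  (∀ f ∈ NC, ∀ g ∈ NC, ∀ h ∈ NC, S (S f g) h = S f (S g h)) ∧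
  (∀ f ∈ NC, S f (ind {0}) = f) ∧
  (∀ f ∈ NC, ∀ g ∈ NC, ∀ h ∈ NC, sqle f g → sqle (S f h) (S g h))

/-- A `t_r`-norm on `L`: an operation on `L` satisfying axioms (O1)--(O7). -/
def IsTrNorm (T : (I01 → I01) → (I01 → I01) → (I01 → I01)) : Prop :=
  (∀ f ∈ NC, ∀ g ∈ NC, T f g ∈ NC) ∧
  (∀ f ∈ NC, ∀ g ∈ NC, T f g = T g f) ∧
  (∀ f ∈ NC, ∀ g ∈ NC, ∀ h ∈ NC, T (T f g) h = T f (T g h)) ∧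
  (∀ f ∈ NC, T f (ind {1}) = f) ∧
  (∀ f ∈ NC, ∀ g ∈ NC, ∀ h ∈ NC, sqle f g → sqle (T f h) (T g h)) ∧
  (∀ a b : I01, a ≤ b → T (ind (Set.Icc 0 1)) (ind (Set.Icc a b)) = ind (Set.Icc 0 b)) ∧
  (∀ x₁ x₂ : I01, ∃ x₃ : I01, T (ind {x₁}) (ind {x₂}) = ind {x₃}) ∧
  (∀ a₁ b₁ a₂ b₂ : I01, a₁ ≤ b₁ → a₂ ≤ b₂ →
    ∃ a₃ b₃ : I01, a₃ ≤ b₃ ∧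
      T (ind (Set.Icc a₁ b₁)) (ind (Set.Icc a₂ b₂)) = ind (Set.Icc a₃ b₃))

/-- A `t_r`-conorm on `L`: an operation on `L` satisfying axioms
(O1), (O2), (O3'), (O4), (O5'), (O6), (O7). -/
def IsTrConorm (S : (I01 → I01) → (I01 → I01) → (I01 → I01)) : Prop :=
  (∀ f ∈ NC, ∀ g ∈ NC, S f g ∈ NC) ∧
  (∀ f ∈ NC, ∀ g ∈ NC, S f g = S g f) ∧
  (∀ f ∈ NC, ∀ g ∈ NC, ∀ h ∈ NC, S (S f g) h = S f (S g h)) ∧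
  (∀ f ∈ NC, S f (ind {0}) = f) ∧
  (∀ f ∈ NC, ∀ g ∈ NC, ∀ h ∈ NC, sqle f g → sqle (S f h) (S g h)) ∧
  (∀ a b : I01, a ≤ b → S (ind (Set.Icc 0 1)) (ind (Set.Icc a b)) = ind (Set.Icc a 1)) ∧
  (∀ x₁ x₂ : I01, ∃ x₃ : I01, S (ind {x₁}) (ind {x₂}) = ind {x₃}) ∧
  (∀ a₁ b₁ a₂ b₂ : I01, a₁ ≤ b₁ → a₂ ≤ b₂ →
    ∃ a₃ b₃ : I01, a₃ ≤ b₃ ∧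
      S (ind (Set.Icc a₁ b₁)) (ind (Set.Icc a₂ b₂)) = ind (Set.Icc a₃ b₃))

theorem le_funL (f : I01 → I01) {x y : I01} (h : y ≤ x) : f y ≤ funL f x :=
  le_sSup ⟨y, h, rfl⟩

theorem le_funR (f : I01 → I01) {x y : I01} (h : x ≤ y) : f y ≤ funR f x :=
  le_sSup ⟨y, h, rfl⟩

theorem funL_mono (f : I01 → I01) {x y : I01} (h : x ≤ y) : funL f x ≤ funL f y :=
  sSup_le_sSup (Set.image_mono fun _ hz => le_trans hz h)

theorem eq_one_of_forall_lt_le {a : I01} (h : ∀ c : I01, c < 1 → c ≤ a) : a = 1 :=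
  le_antisymm unitInterval.le_one' (le_of_forall_lt_imp_le_of_dense h)

theorem NormalFn.exists_lt {f : I01 → I01} (hf : NormalFn f) {c : I01} (hc : c < 1) :
    ∃ y, c < f y := by
  rw [← hf, lt_sSup_iff] at hc
  obtain ⟨_, ⟨y, rfl⟩, hy⟩ := hc
  exact ⟨y, hy⟩

/-- If `f^R x < 1`, the supremum of a normal `f` is approached strictly to the left of `x`. -/
theorem NormalFn.exists_lt_of_funR_lt_one {f : I01 → I01} (hf : NormalFn f) {x c : I01}
    (hx : funR f x < 1) (hc : c < 1) : ∃ y < x, c < f y := by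
  obtain ⟨y, hy⟩ := hf.exists_lt (max_lt hc hx)
  refine ⟨y, ?_, (le_max_left _ _).trans_lt hy⟩
  by_contra! h
  exact ((le_max_right _ _).trans_lt hy).not_ge (le_funR f h)

theorem NormalFn.sInf_funL_le_sSup_funR {f : I01 → I01} (hf : NormalFn f) :
    sInf {x | funL f x = 1} ≤ sSup {x | funR f x = 1} := by
  refine le_of_forall_gt_imp_ge_of_dense fun x hx => sInf_le ?_
  have hR : funR f x < 1 :=
    lt_of_le_of_ne unitInterval.le_one' fun h => hx.not_ge (le_sSup h)
  refine eq_one_of_forall_lt_le fun c hc => ?_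
  obtain ⟨y, hy, hcy⟩ := hf.exists_lt_of_funR_lt_one hR hc
  exact hcy.le.trans (le_funL f hy.le)

theorem etaLG_le_xiLG {f g : I01 → I01} (hf : NormalFn f) (hg : NormalFn g) :
    etaLG f g ≤ xiLG f g :=
  min_le_min hf.sInf_funL_le_sSup_funR hg.sInf_funL_le_sSup_funR

theorem starOp_of_lt_etaLG {f g : I01 → I01} (hf1 : f ≠ ind {1}) (hg1 : g ≠ ind {1})
    {t : I01} (ht : t < etaLG f g) :
    starOp f g t = max (funL f t) (funL g t) := by
  simp [starOp, hf1, hg1, ht]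

theorem starOp_of_lt_xiLG {f g : I01 → I01} (hf1 : f ≠ ind {1}) (hg1 : g ≠ ind {1})
    {t : I01} (h : etaLG f g ≤ t) (ht : t < xiLG f g) : starOp f g t = 1 := by
  simp [starOp, hf1, hg1, h.not_gt, ht]

theorem starOp_xiLG {f g : I01 → I01} (hf1 : f ≠ ind {1}) (hg1 : g ≠ ind {1})
    (h : etaLG f g ≤ xiLG f g) :
    starOp f g (xiLG f g) = min (funR f (xiLG f g)) (funR g (xiLG f g)) := by
  simp [starOp, hf1, hg1, h.not_gt]

theorem starOp_of_xiLG_lt {f g : I01 → I01} (hf1 : f ≠ ind {1}) (hg1 : g ≠ ind {1})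
    {t : I01} (h : etaLG f g ≤ xiLG f g) (ht : xiLG f g < t) :
    starOp f g t = 0 := by
  simp [starOp, hf1, hg1, (h.trans ht.le).not_gt, ht.not_gt, ht.ne']

/-- Values of `f ✶ g` arbitrarily close to `1` occur at, or arbitrarily near the left of, `ξ`. -/
theorem exists_lt_starOp {f g : I01 → I01} (hf1 : f ≠ ind {1}) (hg1 : g ≠ ind {1})
    (hf : NormalFn f) (hg : NormalFn g) {c : I01} (hc : c < 1)
    (h : etaLG f g = xiLG f g) (h1 : starOp f g (xiLG f g) ≠ 1) :
    ∃ y < xiLG f g, ∀ s, y ≤ s → s < xiLG f g → c < starOp f g s := by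
  have hlt := lt_of_le_of_ne unitInterval.le_one' h1
  rw [starOp_xiLG hf1 hg1 h.le, min_lt_iff] at hlt
  rcases hlt with hR | hR
  · obtain ⟨y, hy, hcy⟩ := hf.exists_lt_of_funR_lt_one hR hc
    refine ⟨y, hy, fun s hys hs => ?_⟩
    rw [starOp_of_lt_etaLG hf1 hg1 (h ▸ hs)]
    exact lt_max_of_lt_left (hcy.trans_le (le_funL f hys))
  · obtain ⟨y, hy, hcy⟩ := hg.exists_lt_of_funR_lt_one hR hc
    refine ⟨y, hy, fun s hys hs => ?_⟩
    rw [starOp_of_lt_etaLG hf1 hg1 (h ▸ hs)]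
    exact lt_max_of_lt_right (hcy.trans_le (le_funL g hys))

/-- the formulas for `(f ✶ g)^L` and `(f ✶ g)^R`. -/
theorem stmt7 (f g : I01 → I01) (hf : f ∈ NC) (hg : g ∈ NC)
    (hf1 : f ≠ ind {1}) (hg1 : g ≠ ind {1}) :
    (∀ t : I01, t < etaLG f g → funL (starOp f g) t = max (funL f t) (funL g t)) ∧
    (∀ t : I01, etaLG f g ≤ t → funL (starOp f g) t = 1) ∧
    (∀ t : I01, t < xiLG f g → funR (starOp f g) t = 1) ∧
    funR (starOp f g) (xiLG f g) = min (funR f (xiLG f g)) (funR g (xiLG f g)) ∧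
    (∀ t : I01, xiLG f g < t → funR (starOp f g) t = 0) := by
  have hle := etaLG_le_xiLG hf.1 hg.1
  refine ⟨fun t ht => le_antisymm ?_ ?_, fun t ht => eq_one_of_forall_lt_le fun c hc => ?_,
    fun t ht => eq_one_of_forall_lt_le fun c hc => ?_, ?_, fun t ht => ?_⟩
  · refine sSup_le ?_
    rintro _ ⟨s, hs, rfl⟩
    rw [starOp_of_lt_etaLG hf1 hg1 (lt_of_le_of_lt hs ht)]
    exact max_le_max (funL_mono f hs) (funL_mono g hs)
  · rw [← starOp_of_lt_etaLG hf1 hg1 ht]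
    exact le_funL _ le_rfl
  · suffices ∃ s ≤ etaLG f g, c ≤ starOp f g s by
      obtain ⟨s, hs, hcs⟩ := this
      exact hcs.trans (le_funL _ (hs.trans ht))
    rcases hle.lt_or_eq with h | h
    · exact ⟨_, le_rfl, hc.le.trans (starOp_of_lt_xiLG hf1 hg1 le_rfl h).ge⟩
    · by_cases h1 : starOp f g (xiLG f g) = 1
      · exact ⟨_, h.ge, hc.le.trans h1.ge⟩
      · obtain ⟨y, hy, hcy⟩ := exists_lt_starOp hf1 hg1 hf.1 hg.1 hc h h1
        exact ⟨y, hy.le.trans h.ge, (hcy y le_rfl hy).le⟩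
  · suffices ∃ s, t ≤ s ∧ c ≤ starOp f g s by
      obtain ⟨s, hs, hcs⟩ := this
      exact hcs.trans (le_funR _ hs)
    rcases hle.lt_or_eq with h | h
    · exact ⟨max t (etaLG f g), le_max_left _ _,
        hc.le.trans (starOp_of_lt_xiLG hf1 hg1 (le_max_right _ _) (max_lt ht h)).ge⟩
    · by_cases h1 : starOp f g (xiLG f g) = 1
      · exact ⟨_, ht.le, hc.le.trans h1.ge⟩
      · obtain ⟨y, hy, hcy⟩ := exists_lt_starOp hf1 hg1 hf.1 hg.1 hc h h1
        exact ⟨max t y, le_max_left _ _, (hcy _ (le_max_right _ _) (max_lt ht hy)).le⟩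
  · rw [← starOp_xiLG hf1 hg1 hle]
    refine le_antisymm (sSup_le ?_) (le_funR _ le_rfl)
    rintro _ ⟨s, hs, rfl⟩
    rcases (show xiLG f g ≤ s from hs).eq_or_lt with h | h
    · rw [← h]
    · rw [starOp_of_xiLG_lt hf1 hg1 hle h]
      exact unitInterval.nonneg'
  · refine le_antisymm (sSup_le ?_) unitInterval.nonneg'
    rintro _ ⟨s, hs, rfl⟩
    exact (starOp_of_xiLG_lt hf1 hg1 hle (lt_of_lt_of_le ht hs)).le
end
end

section
/- For all intervals [a₁, b₁], [a₂, b₂] ⊆ I, one has 1_{[a₁,b₁]} ✶ 1_{[a₂,b₂]} = 1_{[min(a₁,a₂), min(b₁,b₂)]}. In particular, ✶ is closed on K = {1_{[a,b]} : 0 ≤ a ≤ b ≤ 1}. -/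
noncomputable section

attribute [local instance] Classical.propDecidable

theorem funL_ind_Icc {a b : I01} (h : a ≤ b) (x : I01) :
    funL (ind (Set.Icc a b)) x = if a ≤ x then 1 else 0 := by
  unfold funL
  split_ifs with hx
  · exact le_antisymm unitInterval.le_one'
      (le_sSup ⟨a, hx, if_pos (Set.left_mem_Icc.2 h)⟩)
  · refine le_antisymm (sSup_le ?_) unitInterval.nonneg'
    rintro _ ⟨y, hy, rfl⟩
    exact (if_neg fun hm => hx (hm.1.trans hy)).le

theorem funR_ind_Icc {a b : I01} (h : a ≤ b) (x : I01) :
    funR (ind (Set.Icc a b)) x = if x ≤ b then 1 else 0 := by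
  unfold funR
  split_ifs with hx
  · exact le_antisymm unitInterval.le_one'
      (le_sSup ⟨b, hx, if_pos (Set.right_mem_Icc.2 h)⟩)
  · refine le_antisymm (sSup_le ?_) unitInterval.nonneg'
    rintro _ ⟨y, hy, rfl⟩
    exact (if_neg fun hm => hx (le_trans hy hm.2)).le

theorem sInf_funL_ind_Icc {a b : I01} (h : a ≤ b) :
    sInf {x | funL (ind (Set.Icc a b)) x = 1} = a := by
  have : {x | funL (ind (Set.Icc a b)) x = 1} = Set.Ici a := by
    ext x; simp [funL_ind_Icc h]
  rw [this, (isLeast_Ici.isGLB).sInf_eq]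

theorem sSup_funR_ind_Icc {a b : I01} (h : a ≤ b) :
    sSup {x | funR (ind (Set.Icc a b)) x = 1} = b := by
  have : {x | funR (ind (Set.Icc a b)) x = 1} = Set.Iic b := by
    ext x; simp [funR_ind_Icc h]
  rw [this, (isGreatest_Iic.isLUB).sSup_eq]

theorem ind_injective : Function.Injective ind := by
  intro A B h
  ext x
  have hx := congrFun h x
  by_cases hA : x ∈ A <;> by_cases hB : x ∈ B <;> simp_all [ind]

theorem eq_one_of_ind_Icc_eq {a b : I01} (h : a ≤ b) (e : ind (Set.Icc a b) = ind {1}) :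
    a = 1 ∧ b = 1 := by
  have e' := ind_injective e
  have ha : a ∈ ({1} : Set I01) := e' ▸ Set.left_mem_Icc.2 h
  have hb : b ∈ ({1} : Set I01) := e' ▸ Set.right_mem_Icc.2 h
  exact ⟨ha, hb⟩

/-- `1_{[a₁,b₁]} ✶ 1_{[a₂,b₂]} = 1_{[min a₁ a₂, min b₁ b₂]}`;
in particular `✶` is closed on `K`. -/
theorem stmt14 (a₁ b₁ a₂ b₂ : I01) (h₁ : a₁ ≤ b₁) (h₂ : a₂ ≤ b₂) :
    starOp (ind (Set.Icc a₁ b₁)) (ind (Set.Icc a₂ b₂)) =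
      ind (Set.Icc (min a₁ a₂) (min b₁ b₂)) := by
  unfold starOp
  split_ifs with hf hg
  · obtain ⟨rfl, rfl⟩ := eq_one_of_ind_Icc_eq h₁ hf
    rw [min_eq_right unitInterval.le_one', min_eq_right unitInterval.le_one']
  · obtain ⟨rfl, rfl⟩ := eq_one_of_ind_Icc_eq h₂ hg
    rw [min_eq_left unitInterval.le_one', min_eq_left unitInterval.le_one']
  · funext t
    simp only [etaLG, xiLG, sInf_funL_ind_Icc h₁, sInf_funL_ind_Icc h₂,
      sSup_funR_ind_Icc h₁, sSup_funR_ind_Icc h₂]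
    simp only [funL_ind_Icc h₁, funL_ind_Icc h₂, funR_ind_Icc h₁, funR_ind_Icc h₂,
      if_pos (min_le_left b₁ b₂), if_pos (min_le_right b₁ b₂), min_self, ind, Set.mem_Icc]
    by_cases hη : t < min a₁ a₂
    · obtain ⟨h1, h2⟩ := lt_min_iff.1 hη
      rw [if_pos hη, if_neg h1.not_ge, if_neg h2.not_ge, if_neg fun h => hη.not_ge h.1, max_self]
    · rw [if_neg hη]
      rcases lt_trichotomy t (min b₁ b₂) with hξ | hξ | hξ
      · rw [if_pos hξ, if_pos ⟨not_lt.1 hη, hξ.le⟩]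
      · rw [if_neg hξ.not_lt, if_pos hξ, if_pos ⟨not_lt.1 hη, hξ.le⟩]
      · rw [if_neg hξ.not_gt, if_neg hξ.ne', if_neg fun h => hξ.not_ge h.2]
end
end
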